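/- arXiv:1210.5152 — 7 statements merged into one kernel-verified Lean document; each statement's English description precedes it below -/
import Mathlib

section
/- Let b ≥ 2, s ≥ 1, and 0 ≤ u ≤ m be integers and let e = (e_1,...,e_s) be an s-tuple of positive integers. Then any (u,m,e,s)-net in base b is a (t,m,s)-net in base b with t = min(u + Σ_{i=1}^s (e_i − 1), m). -/
/-- `x ∈ [0,1)^s` lies in the elementary interval in base `b` determined by the
exponents `d` and numerators `a`, namely `∏_i [a i / b ^ d i, (a i + 1) / b ^ d i)`. -/
def MemElemInterval {s : ℕ} (b : ℕ) (d a : Fin s → ℕ) (x : Fin s → ℝ) : Prop :=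
  ∀ i, (a i : ℝ) / (b : ℝ) ^ d i ≤ x i ∧ x i < ((a i : ℝ) + 1) / (b : ℝ) ^ d i

/-- Elementary intervals are the fibres of the coordinatewise digit truncation. -/
theorem memElemInterval_iff_floor {s b : ℕ} (hb : 0 < b) (d a : Fin s → ℕ) {x : Fin s → ℝ}
    (hx : ∀ i, 0 ≤ x i) :
    MemElemInterval b d a x ↔ ∀ i, ⌊x i * (b : ℝ) ^ d i⌋₊ = a i := by
  refine forall_congr' fun i => ?_
  have hpos : (0 : ℝ) < (b : ℝ) ^ d i := by positivity
  rw [Nat.floor_eq_iff (mul_nonneg (hx i) hpos.le), div_le_iff₀ hpos, lt_div_iff₀ hpos]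

theorem floor_mul_pow_add_div {b : ℕ} (hb : 0 < b) (d r : ℕ) (x : ℝ) :
    ⌊x * (b : ℝ) ^ (d + r)⌋₊ / b ^ r = ⌊x * (b : ℝ) ^ d⌋₊ := by
  have hpos : (b : ℝ) ^ r ≠ 0 := by positivity
  rw [← Nat.floor_div_natCast]
  push_cast
  rw [pow_add, ← mul_assoc, mul_div_cancel_right₀ _ hpos]

/-- An elementary interval is the disjoint union of `b ^ ∑ i, r i` elementary intervals with
exponents `d + r`, so equal counts in the latter determine the count in the former. -/
theorem card_memElemInterval_of_refinement {ι : Type*} [Finite ι] {s b : ℕ} (hb : 0 < b)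
    (d r a : Fin s → ℕ) (ha : ∀ i, a i < b ^ d i)
    (P : ι → Fin s → ℝ) (hP : ∀ n i, 0 ≤ P n i) (N : ℕ)
    (hN : ∀ k : Fin s → ℕ, (∀ i, k i < b ^ (d i + r i)) →
      Nat.card {n // MemElemInterval b (fun i => d i + r i) k (P n)} = N) :
    Nat.card {n // MemElemInterval b d a (P n)} = b ^ (∑ i, r i) * N := by
  classical
  have := Fintype.ofFinite ι
  set T := Fintype.piFinset fun i => Finset.Ico (a i * b ^ r i) (a i * b ^ r i + b ^ r i) with hT
  have mem_T (k : Fin s → ℕ) : k ∈ T ↔ ∀ i, k i / b ^ r i = a i := by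
    simp only [hT, Fintype.mem_piFinset, Finset.mem_Ico]
    refine forall_congr' fun i => ?_
    have hr : 0 < b ^ r i := by positivity
    rw [Nat.div_eq_iff hr]
    omega
  have mem_iff (n : ι) : MemElemInterval b d a (P n) ↔
      (fun i => ⌊P n i * (b : ℝ) ^ (d i + r i)⌋₊) ∈ T := by
    simp only [mem_T, floor_mul_pow_add_div hb, memElemInterval_iff_floor hb d a (hP n)]
  rw [Nat.card_eq_fintype_card, Fintype.card_subtype,
    Finset.card_eq_sum_card_fiberwise (t := T)
      (f := fun n i => ⌊P n i * (b : ℝ) ^ (d i + r i)⌋₊)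
      (fun n hn => (mem_iff n).1 (by simpa using hn))]
  have card_T : T.card = b ^ ∑ i, r i := by
    simp [hT, Fintype.card_piFinset, Finset.prod_pow_eq_pow_sum]
  rw [← card_T, ← smul_eq_mul, ← Finset.sum_const]
  refine Finset.sum_congr rfl fun k hk => ?_
  have hk' : ∀ i, k i < b ^ (d i + r i) := fun i => by
    have h := (mem_T k).1 hk i ▸ ha i
    rwa [Nat.div_lt_iff_lt_mul (by positivity), ← pow_add] at h
  rw [← hN k hk', Nat.card_eq_fintype_card, Fintype.card_subtype, Finset.filter_filter]
  congr 1
  ext n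
  simp only [Finset.mem_filter, Finset.mem_univ, true_and, mem_iff,
    memElemInterval_iff_floor hb _ k (hP n), ← funext_iff (g := k)]
  exact ⟨fun h => h.2, fun h => ⟨h ▸ hk, h⟩⟩

theorem exists_dvd_add_le {e : ℕ} (he : 1 ≤ e) (d : ℕ) :
    ∃ r, e ∣ d + r ∧ r ≤ e - 1 ∧ (d = 0 → r = 0) := by
  have h := Nat.div_add_mod (d + (e - 1)) e
  have h' := Nat.mod_lt (d + (e - 1)) he
  refine ⟨e * ((d + (e - 1)) / e) - d, ?_, by omega, ?_⟩
  · rw [Nat.add_sub_cancel' (by omega)]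
    exact dvd_mul_right _ _
  · rintro rfl
    rw [Nat.div_eq_of_lt (by omega)]
    simp


/-- Any `(u, m, e, s)`-net in base `b` is a `(t, m, s)`-net in base `b` with
`t = min (u + ∑ i (e i - 1)) m`. -/
theorem stmt0 (b s u m : ℕ) (hb : 2 ≤ b) (hs : 1 ≤ s) (hum : u ≤ m)
    (e : Fin s → ℕ) (he : ∀ i, 1 ≤ e i)
    (P : Fin (b ^ m) → Fin s → ℝ) (hP : ∀ n i, P n i ∈ Set.Ico (0 : ℝ) 1)
    (hnet : ∀ d a : Fin s → ℕ, (∀ i, e i ∣ d i) → (∀ i, a i < b ^ d i) →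
      u + ∑ i, d i ≤ m →
      Nat.card {n : Fin (b ^ m) // MemElemInterval b d a (P n)} = b ^ (m - ∑ i, d i)) :
    ∀ d a : Fin s → ℕ, (∀ i, a i < b ^ d i) →
      ∑ i, d i = m - min (u + ∑ i, (e i - 1)) m →
      Nat.card {n : Fin (b ^ m) // MemElemInterval b d a (P n)}
        = b ^ min (u + ∑ i, (e i - 1)) m := by
  intro d a ha hd
  have hb0 : 0 < b := by omega
  choose r hdvd hr hr0 using fun i => exists_dvd_add_le (he i) (d i)
  have hle : ∑ i, r i ≤ ∑ i, (e i - 1) := Finset.sum_le_sum fun i _ => hr i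
  have hsum : ∑ i, (d i + r i) = ∑ i, d i + ∑ i, r i := Finset.sum_add_distrib
  have hm : u + ∑ i, (d i + r i) ≤ m := by
    rcases le_total (u + ∑ i, (e i - 1)) m with h | h
    · rw [min_eq_left h] at hd
      omega
    · have hd0 : ∑ i, d i = 0 := by rw [hd, min_eq_right h, Nat.sub_self]
      have hrs : ∑ i, r i = 0 := Finset.sum_eq_zero fun i hi =>
        hr0 i (Finset.sum_eq_zero_iff.1 hd0 i hi)
      omega
  rw [card_memElemInterval_of_refinement hb0 d r a ha P (fun n i => (hP n i).1) _
    (fun k hk => hnet _ k hdvd hk hm), ← pow_add]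
  congr 1
  omega
end

section
/- Let q be a prime power, F_q a finite field with q elements, let m ≥ 1, s ≥ 1, 0 ≤ u ≤ m be integers, and let e = (e_1,...,e_s) be positive integers. Let C^{(1)},...,C^{(s)} be m×m matrices over F_q. Fix arbitrary bijections ψ_r : {0,...,q−1} → F_q for 0 ≤ r ≤ m−1 and λ_{i,j} : F_q → {0,...,q−1} for 1 ≤ i ≤ s, 1 ≤ j ≤ m, and for 0 ≤ n < q^m with base-q digits n = Σ_{r=0}^{m−1} z_r(n) q^r define the point x_n = (x_n^{(1)},...,x_n^{(s)}) ∈ [0,1)^s by x_n^{(i)} = Σ_{j=1}^m λ_{i,j}(y_{n,j}^{(i)}) q^{-j}, where (y_{n,1}^{(i)},...,y_{n,m}^{(i)})^T = C^{(i)} · (ψ_0(z_0(n)),...,ψ_{m−1}(z_{m−1}(n)))^T over F_q. Then the point set (x_n)_{n=0}^{q^m−1} is a (u,m,e,s)-net in base q if and only if, for any integers d_1,...,d_s ≥ 0 with e_i | d_i for 1 ≤ i ≤ s and d_1 + ⋯ + d_s ≤ m − u, the collection of d_1 + ⋯ + d_s vectors obtained by taking the first d_i row vectors of C^{(i)} for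 1 ≤ i ≤ s is linearly independent over F_q (an empty collection being linearly independent by convention). -/
/-- The base-`q` digits of `n < q ^ m` determine `n`. -/
theorem Nat.eq_of_digits_eq {q d a b : ℕ} (ha : a < q ^ d) (hb : b < q ^ d)
    (h : ∀ k < d, a / q ^ k % q = b / q ^ k % q) : a = b := by
  have key : (⟨a, ha⟩ : Fin (q ^ d)) = ⟨b, hb⟩ := by
    apply finFunctionFinEquiv.symm.injective
    funext k
    apply Fin.ext
    simpa [finFunctionFinEquiv] using h k k.2
  exact congrArg Fin.val key

/-- The base-`q` digits of a number given by its base-`q` expansion. -/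
theorem sum_mul_pow_div_pow_mod {q m : ℕ} (c : Fin m → Fin q) (k : Fin m) :
    (∑ j : Fin m, (c j : ℕ) * q ^ (j : ℕ)) / q ^ (k : ℕ) % q = c k := by
  have h := congrFun (finFunctionFinEquiv.symm_apply_apply c) k
  have h' := congrArg Fin.val h
  rw [finFunctionFinEquiv_symm_apply_val, finFunctionFinEquiv_apply] at h'
  exact h'

/-- A `q`-adic fraction with digits `c` lies in `[a / q ^ d, (a + 1) / q ^ d)` if and only
if its first `d` digits are those of `a`. -/
theorem sum_digits_mem_interval_iff {q m d a : ℕ} (hq : 2 ≤ q) (hd : d ≤ m) (ha : a < q ^ d)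
    (c : Fin m → Fin q) :
    ((a : ℝ) / (q : ℝ) ^ d ≤ ∑ j : Fin m, ((c j : ℕ) : ℝ) / (q : ℝ) ^ ((j : ℕ) + 1) ∧
      ∑ j : Fin m, ((c j : ℕ) : ℝ) / (q : ℝ) ^ ((j : ℕ) + 1) < ((a : ℝ) + 1) / (q : ℝ) ^ d) ↔
    ∀ j : Fin m, (j : ℕ) < d → (c j : ℕ) = a / q ^ (d - 1 - j) % q := by
  have hq0 : 0 < q := by omega
  have hqr : (0 : ℝ) < q := by exact_mod_cast hq0
  set A : ℕ := ∑ j : Fin m, (c (Fin.rev j) : ℕ) * q ^ (j : ℕ) with hA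
  have hAlt : A < q ^ m := by
    have h := (finFunctionFinEquiv (fun j : Fin m => c (Fin.rev j))).2
    rwa [finFunctionFinEquiv_apply] at h
  have hsum : ∑ j : Fin m, ((c j : ℕ) : ℝ) / (q : ℝ) ^ ((j : ℕ) + 1) = (A : ℝ) / (q : ℝ) ^ m := by
    rw [hA, Nat.cast_sum, Finset.sum_div, ← Equiv.sum_comp Fin.revPerm]
    refine Finset.sum_congr rfl fun j _ => ?_
    have hj : m = (Fin.rev j : ℕ) + 1 + j := by rw [Fin.val_rev]; omega
    rw [Fin.revPerm_apply, Nat.cast_mul, Nat.cast_pow, div_eq_div_iff (by positivity) (by positivity),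
      mul_assoc, ← pow_add]
    congr 2
    omega
  have hdm : (q : ℝ) ^ m = (q : ℝ) ^ (m - d) * (q : ℝ) ^ d := by
    rw [← pow_add]; congr 1; omega
  have hdiv : ((a : ℝ) / (q : ℝ) ^ d ≤ (A : ℝ) / (q : ℝ) ^ m ∧
      (A : ℝ) / (q : ℝ) ^ m < ((a : ℝ) + 1) / (q : ℝ) ^ d) ↔ A / q ^ (m - d) = a := by
    rw [hdm, ← div_div, div_le_div_iff_of_pos_right (by positivity),
      div_lt_div_iff_of_pos_right (by positivity), le_div_iff₀ (by positivity),
      div_lt_iff₀ (by positivity), Nat.div_eq_iff (by positivity)]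
    constructor
    · rintro ⟨h1, h2⟩
      have h1' : a * q ^ (m - d) ≤ A := by exact_mod_cast h1
      have h2' : A < (a + 1) * q ^ (m - d) := by exact_mod_cast h2
      rw [add_mul] at h2'
      omega
    · rintro ⟨h1, h2⟩
      have hp : 0 < q ^ (m - d) := by positivity
      have h2' : A < (a + 1) * q ^ (m - d) := by rw [add_mul]; omega
      exact ⟨by exact_mod_cast h1, by exact_mod_cast h2'⟩
  have hdig : ∀ k (hk : k < d), A / q ^ (m - d) / q ^ k % q = c ⟨d - 1 - k, by omega⟩ := by
    intro k hk
    have h := sum_mul_pow_div_pow_mod (fun j : Fin m => c (Fin.rev j)) ⟨m - d + k, by omega⟩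
    rw [Nat.div_div_eq_div_mul, ← pow_add]
    refine h.trans ?_
    congr 2
    apply Fin.ext
    simp only [Fin.val_rev]
    omega
  rw [hsum, hdiv]
  constructor
  · rintro rfl j hj
    rw [hdig (d - 1 - j) (by omega)]
    congr 2
    apply Fin.ext
    simp only
    omega
  · intro h
    refine Nat.eq_of_digits_eq (d := d) ?_ ha fun k hk => ?_
    · rw [Nat.div_lt_iff_lt_mul (by positivity), ← pow_add]
      convert hAlt using 2
      omega
    · rw [hdig k hk, h _ (by simp only; omega)]
      congr 3
      simp only
      omega

/-- The rows of a matrix over a finite field are linearly independent if and only if all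
the associated inhomogeneous linear systems have the same expected number of solutions. -/
theorem Matrix.linearIndependent_row_iff_card_fiber {F ι κ : Type*} [Field F] [Fintype F]
    [Fintype ι] [Fintype κ] (M : Matrix ι κ F) :
    LinearIndependent F M.row ↔
      ∀ w : ι → F, Nat.card {v : κ → F // M.mulVec v = w} =
        Fintype.card F ^ (Fintype.card κ - Fintype.card ι) := by
  classical
  constructor
  · intro h w
    have hrank := h.rank_matrix
    rw [Matrix.rank] at hrank
    have htop : LinearMap.range M.mulVecLin = ⊤ :=
      Submodule.eq_top_of_finrank_eq (by rw [hrank, Module.finrank_fintype_fun_eq_card])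
    obtain ⟨v₀, hv₀⟩ := LinearMap.range_eq_top.mp htop w
    have hker : Module.finrank F (LinearMap.ker M.mulVecLin) = Fintype.card κ - Fintype.card ι := by
      have := M.mulVecLin.finrank_range_add_finrank_ker
      rw [hrank, Module.finrank_fintype_fun_eq_card] at this
      omega
    rw [← hker, ← Nat.card_eq_fintype_card, ← Module.natCard_eq_pow_finrank]
    refine Nat.card_congr ((Equiv.subRight v₀).subtypeEquiv fun v => ?_)
    rw [Matrix.mulVecLin_apply] at hv₀
    simp [LinearMap.mem_ker, Matrix.mulVec_sub, hv₀, sub_eq_zero]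
  · intro h
    rw [← Matrix.vecMul_injective_iff]
    refine (injective_iff_map_eq_zero M.vecMulLinear).mpr fun g hg => ?_
    ext i
    have hpos : 0 < Nat.card {v : κ → F // M.mulVec v = Pi.single i 1} := by
      rw [h]; exact pow_pos Fintype.card_pos _
    obtain ⟨v, hv⟩ := (Nat.card_pos_iff.mp hpos).1
    have := Matrix.dotProduct_mulVec g M v
    rw [hv, show Matrix.vecMul g M = 0 from hg] at this
    simpa using this

/-- The number of pairs `(i, j)` with `j < d i`. -/
theorem card_subtype_snd_lt {s m : ℕ} {d : Fin s → ℕ} (hd : ∀ i, d i ≤ m) :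
    Fintype.card {p : Fin s × Fin m // (p.2 : ℕ) < d p.1} = ∑ i, d i := by
  rw [Fintype.card_subtype, Finset.card_filter, Fintype.sum_prod_type]
  refine Finset.sum_congr rfl fun i _ => ?_
  rw [← Finset.card_filter]
  exact Fin.card_filter_val_lt.trans (min_eq_right (hd i))

/-- The input vectors of the digital method run through all of `F ^ m`. -/
theorem bijective_digit_vector {q m : ℕ} {F : Type*} (hq : 0 < q) (ψ : Fin m → Fin q → F)
    (hψ : ∀ r, Function.Bijective (ψ r)) :
    Function.Bijective (fun (n : Fin (q ^ m)) (r : Fin m) =>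
      ψ r ⟨(n : ℕ) / q ^ (r : ℕ) % q, Nat.mod_lt _ hq⟩) := by
  convert (finFunctionFinEquiv.symm.trans
    (Equiv.piCongrRight fun r => Equiv.ofBijective (ψ r) (hψ r))).bijective using 1
  funext n r
  simp only [Equiv.trans_apply, Equiv.piCongrRight_apply, Pi.map_apply, Equiv.ofBijective_apply]
  congr 1

/-- The digital method with `m × m` generating matrices `C i` over a finite field `F`
with `q` elements produces a `(u, m, e, s)`-net in base `q` if and only if, for all
`d i ≥ 0` with `e i ∣ d i` and `∑ d i ≤ m - u`, the first `d i` rows of the matrices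
`C i` (`1 ≤ i ≤ s`) are linearly independent over `F`.
For `0 ≤ n < q ^ m` with base-`q` digits `z r = n / q ^ r % q`, the point `x_n` has
`i`-th coordinate `∑_{j < m} λ_{i,j}((C i · (ψ_r(z_r))_r)_j) q^{-(j+1)}`. -/
theorem stmt2 (q : ℕ) (hq : 2 ≤ q) (F : Type) [Field F] [Fintype F]
    (hcard : Fintype.card F = q)
    (m s u : ℕ) (hm : 1 ≤ m) (hs : 1 ≤ s) (hum : u ≤ m)
    (e : Fin s → ℕ) (he : ∀ i, 1 ≤ e i)
    (C : Fin s → Matrix (Fin m) (Fin m) F)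
    (ψ : Fin m → Fin q → F) (hψ : ∀ r, Function.Bijective (ψ r))
    (lam : Fin s → Fin m → F → Fin q) (hlam : ∀ i j, Function.Bijective (lam i j)) :
    (∀ d a : Fin s → ℕ, (∀ i, e i ∣ d i) → (∀ i, a i < q ^ d i) →
        u + ∑ i, d i ≤ m →
        Nat.card {n : Fin (q ^ m) // MemElemInterval q d a (fun i =>
            ∑ j : Fin m,
              ((lam i j ((C i).mulVec
                  (fun r => ψ r ⟨(n : ℕ) / q ^ (r : ℕ) % q, Nat.mod_lt _ (by omega)⟩) j) : ℕ) : ℝ)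
                / (q : ℝ) ^ ((j : ℕ) + 1))}
          = q ^ (m - ∑ i, d i))
    ↔ (∀ d : Fin s → ℕ, (∀ i, e i ∣ d i) → u + ∑ i, d i ≤ m →
        LinearIndependent F
          (fun p : {p : Fin s × Fin m // (p.2 : ℕ) < d p.1} => C p.1.1 p.1.2)) := by
  have hle : ∀ d : Fin s → ℕ, u + ∑ i, d i ≤ m → ∀ i, d i ≤ m := fun d h i =>
    (Finset.single_le_sum (fun _ _ => Nat.zero_le _) (Finset.mem_univ i)).trans
      ((Nat.le_add_left _ u).trans h)
  -- The points in an elementary interval are the solutions of a linear system.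
  have hcount : ∀ d a : Fin s → ℕ, (∀ i, d i ≤ m) → (∀ i, a i < q ^ d i) →
      ∀ w : {p : Fin s × Fin m // (p.2 : ℕ) < d p.1} → F,
      (∀ p, (lam p.1.1 p.1.2 (w p) : ℕ) = a p.1.1 / q ^ (d p.1.1 - 1 - p.1.2) % q) →
      Nat.card {n : Fin (q ^ m) // MemElemInterval q d a (fun i =>
          ∑ j : Fin m,
            ((lam i j ((C i).mulVec
                (fun r => ψ r ⟨(n : ℕ) / q ^ (r : ℕ) % q, Nat.mod_lt _ (by omega)⟩) j) : ℕ) : ℝ)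
              / (q : ℝ) ^ ((j : ℕ) + 1))} =
        Nat.card {v : Fin m → F // (Matrix.of fun p :
          {p : Fin s × Fin m // (p.2 : ℕ) < d p.1} => C p.1.1 p.1.2).mulVec v = w} := by
    intro d a hd ha w hw
    refine Nat.card_congr
      ((Equiv.ofBijective _ (bijective_digit_vector (by omega) ψ hψ)).subtypeEquiv fun n => ?_)
    rw [Equiv.ofBijective_apply, funext_iff]
    refine (forall_congr' fun i => sum_digits_mem_interval_iff hq (hd i) (ha i) _).trans ?_
    constructor
    · intro h p
      exact (hlam p.1.1 p.1.2).1 (Fin.ext ((h p.1.1 p.1.2 p.2).trans (hw p).symm))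
    · intro h i j hj
      rw [← hw ⟨(i, j), hj⟩, ← h ⟨(i, j), hj⟩]
      rfl
  refine ⟨fun h d hed hdm => ?_, fun h d a hed ha hdm => ?_⟩
  · refine (Matrix.linearIndependent_row_iff_card_fiber (Matrix.of fun p :
      {p : Fin s × Fin m // (p.2 : ℕ) < d p.1} => C p.1.1 p.1.2)).mpr fun w => ?_
    have hd := hle d hdm
    let c : (i : Fin s) → Fin (d i) → Fin q := fun i k =>
      lam i ⟨d i - 1 - k, by have := hd i; omega⟩
        (w ⟨(i, ⟨d i - 1 - k, by have := hd i; omega⟩), by simp only; omega⟩)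
    let a : Fin s → ℕ := fun i => finFunctionFinEquiv (c i)
    have ha : ∀ i, a i < q ^ d i := fun i => (finFunctionFinEquiv (c i)).2
    rw [← hcount d a hd ha w, h d a hed ha hdm, hcard, Fintype.card_fin, card_subtype_snd_lt hd]
    rintro ⟨⟨i, j⟩, hj⟩
    dsimp only at hj ⊢
    have hk : d i - 1 - j < d i := by omega
    have hjk : (⟨d i - 1 - (d i - 1 - j), by have := hd i; omega⟩ : Fin m) = j :=
      Fin.ext (by simp only; omega)
    have hdig := sum_mul_pow_div_pow_mod (c i) ⟨d i - 1 - j, hk⟩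
    simp only [a, finFunctionFinEquiv_apply]
    refine Eq.trans ?_ hdig.symm
    simp only [c, hjk]
  · have hd := hle d hdm
    let w : {p : Fin s × Fin m // (p.2 : ℕ) < d p.1} → F := fun p =>
      (Equiv.ofBijective _ (hlam p.1.1 p.1.2)).symm
        ⟨a p.1.1 / q ^ (d p.1.1 - 1 - p.1.2) % q, Nat.mod_lt _ (by omega)⟩
    have hw : ∀ p, (lam p.1.1 p.1.2 (w p) : ℕ) = a p.1.1 / q ^ (d p.1.1 - 1 - p.1.2) % q :=
      fun p => congrArg Fin.val ((Equiv.ofBijective _ (hlam p.1.1 p.1.2)).apply_symm_apply _)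
    rw [hcount d a hd ha w hw, (Matrix.linearIndependent_row_iff_card_fiber (Matrix.of fun p :
      {p : Fin s × Fin m // (p.2 : ℕ) < d p.1} => C p.1.1 p.1.2)).mp (h d hed hdm) w,
      hcard, Fintype.card_fin, card_subtype_snd_lt hd]
end

section
/- Let q be a prime power, F_q a finite field with q elements, let s ≥ 1 and u ≥ 0 be integers, and let e = (e_1,...,e_s) be positive integers. Let C^{(i)} = (c^{(i)}_{j,r})_{j≥1, r≥0}, 1 ≤ i ≤ s, be matrices with entries in F_q and rows indexed by j ≥ 1 and columns by r ≥ 0. Fix bijections ψ_r : {0,...,q−1} → F_q for r ≥ 0 with ψ_r(0) = 0 for all sufficiently large r, and bijections λ_{i,j} : F_q → {0,...,q−1} for 1 ≤ i ≤ s and j ≥ 1. For n ≥ 0 with base-q digit expansion n = Σ_{r≥0} z_r(n) q^r, define x_n^{(i)} = Σ_{j≥1} λ_{i,j}(y_{n,j}^{(i)}) q^{-j} where y_{n,j}^{(i)} = Σ_{r≥0} c^{(i)}_{j,r} ψ_r(z_r(n)), and equip each coordinate x_n^{(i)} with the q-adic expansion given by the digits λ_{i,j}(y_{n,j}^{(i)}).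 Then the sequence (x_n)_{n≥0} of points in [0,1]^s is a (u,e,s)-sequence in base q if and only if, for every integer m > u and all integers d_1,...,d_s ≥ 0 with e_i | d_i for 1 ≤ i ≤ s and 1 ≤ d_1 + ⋯ + d_s ≤ m − u, the (d_1 + ⋯ + d_s) × m matrix over F_q formed by the row vectors (c^{(i)}_{j,0}, c^{(i)}_{j,1},...,c^{(i)}_{j,m−1}) with 1 ≤ j ≤ d_i and 1 ≤ i ≤ s has rank d_1 + ⋯ + d_s. -/
/-- The natural number whose `d` base-`b` digits, most significant first, are `f 0, …, f (d-1)`. -/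
def leadingNat (b : ℕ) (f : ℕ → ℕ) : ℕ → ℕ
  | 0 => 0
  | d + 1 => b * leadingNat b f d + f d

theorem leadingNat_lt {b : ℕ} {f : ℕ → ℕ} (hf : ∀ j, f j < b) (d : ℕ) :
    leadingNat b f d < b ^ d := by
  induction d with
  | zero => simp [leadingNat]
  | succ d ih =>
    have h := Nat.mul_le_mul_left b (Nat.succ_le_of_lt ih)
    have := hf d
    rw [leadingNat, pow_succ']
    rw [Nat.succ_eq_add_one, mul_add] at h
    omega

theorem leadingNat_inj {b : ℕ} {f g : ℕ → ℕ} (hf : ∀ j, f j < b) (hg : ∀ j, g j < b) (d : ℕ) :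
    leadingNat b f d = leadingNat b g d ↔ ∀ j < d, f j = g j := by
  induction d with
  | zero => simp [leadingNat]
  | succ d ih =>
    have hb : 0 < b := (Nat.zero_le _).trans_lt (hf 0)
    rw [Nat.forall_lt_succ_right, ← ih, leadingNat, leadingNat]
    refine ⟨fun h => ?_, fun h => by rw [h.1, h.2]⟩
    have h1 := congrArg (· % b) h
    have h2 := congrArg (· / b) h
    simp only [Nat.mul_add_mod, Nat.mod_eq_of_lt (hf d), Nat.mod_eq_of_lt (hg d)] at h1
    simp only [Nat.mul_add_div hb, Nat.div_eq_of_lt (hf d), Nat.div_eq_of_lt (hg d)] at h2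
    exact ⟨h2, h1⟩

theorem leadingNat_congr {b : ℕ} {f g : ℕ → ℕ} {d : ℕ} (h : ∀ j < d, f j = g j) :
    leadingNat b f d = leadingNat b g d := by
  induction d with
  | zero => rfl
  | succ d ih =>
    rw [leadingNat, leadingNat, ih fun j hj => h j (by omega), h d (by omega)]

theorem exists_leadingNat_eq {b : ℕ} (hb : 0 < b) (d a : ℕ) (ha : a < b ^ d) :
    ∃ g : ℕ → ℕ, (∀ j, g j < b) ∧ leadingNat b g d = a := by
  induction d generalizing a with
  | zero => exact ⟨fun _ => 0, fun _ => hb, by simp [leadingNat] at ha ⊢; omega⟩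
  | succ d ih =>
    obtain ⟨g, hg, hga⟩ := ih (a / b) (Nat.div_lt_of_lt_mul (by rwa [← pow_succ']))
    refine ⟨Function.update g d (a % b), fun j => ?_, ?_⟩
    · rcases eq_or_ne j d with rfl | hj
      · simpa using Nat.mod_lt a hb
      · simpa [hj] using hg j
    · have : leadingNat b (Function.update g d (a % b)) d = leadingNat b g d :=
        leadingNat_congr fun j hj => by simp [hj.ne]
      rw [leadingNat, this, hga, Function.update_self, Nat.div_add_mod]

theorem sum_div_pow_eq_leadingNat {b : ℕ} (hb : 0 < b) (f : ℕ → ℕ) (m : ℕ) :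
    ∑ j ∈ Finset.range m, (f j : ℝ) / (b : ℝ) ^ (j + 1) = leadingNat b f m / (b : ℝ) ^ m := by
  have hb' : (b : ℝ) ≠ 0 := by positivity
  induction m with
  | zero => simp [leadingNat]
  | succ m ih =>
    rw [Finset.sum_range_succ, ih, leadingNat]
    push_cast
    field_simp
    ring

theorem leadingNat_add_bounds {b : ℕ} {f : ℕ → ℕ} (hf : ∀ j, f j < b) (d t : ℕ) :
    leadingNat b f d * b ^ t ≤ leadingNat b f (d + t) ∧
      leadingNat b f (d + t) < (leadingNat b f d + 1) * b ^ t := by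
  induction t with
  | zero => simp
  | succ t ih =>
    have h := Nat.mul_le_mul_left b (Nat.succ_le_of_lt ih.2)
    have h' := Nat.mul_le_mul_left b ih.1
    have := hf (d + t)
    rw [← add_assoc, leadingNat, pow_succ']
    rw [Nat.succ_eq_add_one, mul_add] at h
    constructor
    · calc _ = b * (leadingNat b f d * b ^ t) := by ring
        _ ≤ _ := by omega
    · calc _ < b * ((leadingNat b f d + 1) * b ^ t) := by omega
        _ = _ := by ring

theorem sum_div_pow_mem_iff {b : ℕ} {f : ℕ → ℕ} (hf : ∀ j, f j < b) {d m : ℕ} (hdm : d ≤ m)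
    (a : ℕ) :
    ((a : ℝ) / (b : ℝ) ^ d ≤ ∑ j ∈ Finset.range m, (f j : ℝ) / (b : ℝ) ^ (j + 1) ∧
      ∑ j ∈ Finset.range m, (f j : ℝ) / (b : ℝ) ^ (j + 1) < ((a : ℝ) + 1) / (b : ℝ) ^ d) ↔
      leadingNat b f d = a := by
  have hb : 0 < b := (Nat.zero_le _).trans_lt (hf 0)
  obtain ⟨t, rfl⟩ := Nat.exists_eq_add_of_le hdm
  obtain ⟨h1, h2⟩ := leadingNat_add_bounds hf d t
  have hbt : 0 < b ^ t := by positivity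
  have hbr : (0 : ℝ) < b := by exact_mod_cast hb
  have e1 : ∀ x : ℝ, x / (b : ℝ) ^ d = x * (b : ℝ) ^ t / (b : ℝ) ^ (d + t) := fun x => by
    rw [pow_add]; field_simp
  rw [sum_div_pow_eq_leadingNat hb, e1, e1, div_le_div_iff_of_pos_right (by positivity),
    div_lt_div_iff_of_pos_right (by positivity)]
  norm_cast
  constructor
  · rintro ⟨h3, h4⟩
    have := Nat.lt_of_mul_lt_mul_right (h1.trans_lt h4)
    have := Nat.lt_of_mul_lt_mul_right (h3.trans_lt h2)
    omega
  · rintro rfl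
    exact ⟨h1, h2⟩

theorem Matrix.rank_eq_card_iff_mulVec_surjective {ι κ F : Type*} [Fintype ι] [Fintype κ]
    [Field F] (A : Matrix ι κ F) :
    A.rank = Fintype.card ι ↔ Function.Surjective A.mulVec := by
  rw [Matrix.rank, ← Module.finrank_fintype_fun_eq_card (R := F) (η := ι),
    show A.mulVec = A.mulVecLin from rfl, ← LinearMap.range_eq_top]
  exact ⟨Submodule.eq_top_of_finrank_eq, fun h => by rw [h, finrank_top]⟩

theorem Matrix.card_mulVec_fiber {ι κ F : Type*} [Fintype ι] [Fintype κ] [Field F] [Fintype F]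
    (A : Matrix ι κ F) (hA : Function.Surjective A.mulVec) (w : ι → F) :
    Nat.card {v : κ → F // A.mulVec v = w} =
      Fintype.card F ^ (Fintype.card κ - Fintype.card ι) := by
  obtain ⟨v₀, hv₀⟩ := hA w
  have e : {v : κ → F // A.mulVec v = w} ≃ LinearMap.ker A.mulVecLin :=
    (Equiv.subRight v₀).subtypeEquiv fun v => by
      simp [Matrix.mulVec_sub, hv₀, sub_eq_zero]
  have hr := (Matrix.rank_eq_card_iff_mulVec_surjective A).2 hA
  have hk := LinearMap.finrank_range_add_finrank_ker A.mulVecLin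
  rw [Module.finrank_fintype_fun_eq_card] at hk
  rw [Matrix.rank] at hr
  rw [Nat.card_congr e, Module.natCard_eq_pow_finrank (K := F), Nat.card_eq_fintype_card]
  congr 1
  omega

theorem finsum_mul_digit_block {F : Type*} [Field F] {q : ℕ} (hq : 2 ≤ q) (c : ℕ → F)
    (ψ : ℕ → Fin q → F) {R : ℕ} (hR : ∀ r, R ≤ r → ψ r ⟨0, by omega⟩ = 0) (k m : ℕ)
    (n : Fin (q ^ m)) :
    ∑ᶠ r : ℕ, c r * ψ r ⟨(k * q ^ m + (n : ℕ)) / q ^ r % q, Nat.mod_lt _ (by omega)⟩ =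
      ∑ r : Fin m, c r * ψ r (finFunctionFinEquiv.symm n r) +
      ∑ t ∈ Finset.range (R + k),
        c (m + t) * ψ (m + t) ⟨k / q ^ t % q, Nat.mod_lt _ (by omega)⟩ := by
  have hq0 : 0 < q := by omega
  have hn := n.2
  have hhigh : ∀ t, (k * q ^ m + (n : ℕ)) / q ^ (m + t) = k / q ^ t := fun t => by
    rw [pow_add, ← Nat.div_div_eq_div_mul, mul_comm k, Nat.mul_add_div (by positivity),
      Nat.div_eq_of_lt hn, add_zero]
  rw [finsum_eq_sum_of_support_subset (s := Finset.range (m + (R + k))), Finset.sum_range_add]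
  · congr 1
    · rw [Finset.sum_range]
      refine Finset.sum_congr rfl fun r _ => ?_
      congr 2
      ext
      obtain ⟨t, ht⟩ := Nat.exists_eq_add_of_lt r.2
      have : k * q ^ m = q ^ (r : ℕ) * (q * (k * q ^ t)) := by
        have hm : q ^ m = q ^ (r : ℕ) * q ^ t * q := by
          rw [← pow_add, ← pow_succ, ← ht]
        rw [hm]; ring
      simp only [finFunctionFinEquiv_symm_apply_val]
      rw [this, Nat.mul_add_div (by positivity), Nat.mul_add_mod]
    · refine Finset.sum_congr rfl fun t _ => ?_
      simp only [hhigh]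
  · intro r hr
    by_contra hlt
    simp only [Finset.coe_range, Set.mem_Iio, not_lt] at hlt
    obtain ⟨t, rfl⟩ := Nat.exists_eq_add_of_le (show m ≤ r by omega)
    refine hr ?_
    have hk : k / q ^ t = 0 := Nat.div_eq_of_lt <|
      (Nat.lt_pow_self (by omega : 1 < q)).trans_le (Nat.pow_le_pow_right hq0 (by omega))
    simp only [hhigh, hk, Nat.zero_mod]
    rw [hR _ (by omega), mul_zero]

theorem card_block_memElemInterval {q : ℕ} (hq : 2 ≤ q) {F : Type} [Field F] {s : ℕ}
    (c : Fin s → ℕ → ℕ → F) (ψ : ℕ → Fin q → F) (hψ : ∀ r, Function.Bijective (ψ r))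
    {R : ℕ} (hR : ∀ r, R ≤ r → ψ r ⟨0, by omega⟩ = 0)
    (lam : Fin s → ℕ → F → Fin q) (hlam : ∀ i j, Function.Bijective (lam i j))
    (k m : ℕ) (d : Fin s → ℕ) (hd : ∀ i, d i ≤ m) (γ : Fin s → ℕ → F) :
    Nat.card {n : Fin (q ^ m) // MemElemInterval q d
        (fun i => leadingNat q (fun j => lam i j (γ i j)) (d i)) (fun i =>
          ∑ j ∈ Finset.range m,
            ((lam i j (∑ᶠ r : ℕ, c i j r *
                ψ r ⟨(k * q ^ m + (n : ℕ)) / q ^ r % q, Nat.mod_lt _ (by omega)⟩) : ℕ) : ℝ)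
              / (q : ℝ) ^ (j + 1))} =
      Nat.card {v : Fin m → F //
        (Matrix.of fun (p : Σ i : Fin s, Fin (d i)) (r : Fin m) =>
          c p.1 (p.2 : ℕ) (r : ℕ)).mulVec v =
        fun p => γ p.1 p.2 - ∑ t ∈ Finset.range (R + k),
          c p.1 p.2 (m + t) * ψ (m + t) ⟨k / q ^ t % q, Nat.mod_lt _ (by omega)⟩} := by
  refine Nat.card_congr <| Equiv.subtypeEquiv (finFunctionFinEquiv.symm.trans
    (Equiv.piCongrRight fun r : Fin m => Equiv.ofBijective _ (hψ r))) fun n => ?_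
  have hmem : ∀ (i : Fin s) (y : ℕ → F), _ := fun i y =>
    sum_div_pow_mem_iff (f := fun j => (lam i j (y j) : ℕ)) (fun j => (lam i j (y j)).2) (hd i)
      (leadingNat q (fun j => lam i j (γ i j)) (d i))
  unfold MemElemInterval
  simp only [hmem]
  simp only [leadingNat_inj (fun j => Fin.is_lt _) (fun j => Fin.is_lt _), Fin.val_inj,
    (hlam _ _).injective.eq_iff, finsum_mul_digit_block hq _ ψ hR, funext_iff, eq_sub_iff_add_eq]
  constructor
  · intro h p
    exact h p.1 p.2 p.2.2
  · intro h i j hj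
    exact h ⟨i, ⟨j, hj⟩⟩

/-- The digital method with generating matrices `c i` over a finite field `F` with `q`
elements (rows indexed by `j ∈ ℕ`, standing for row `j+1`, and columns by `r ∈ ℕ`)
produces a `(u, e, s)`-sequence in base `q` if and only if, for every `m > u` and all
`d i ≥ 0` with `e i ∣ d i` and `1 ≤ ∑ d i ≤ m - u`, the `(∑ d i) × m` matrix formed by
the first `d i` rows of each `c i`, restricted to the first `m` columns, has rank `∑ d i`.
Here the `n`-th point has `i`-th coordinate with prescribed digit
`λ_{i,j}(∑_r c^{(i)}_{j,r} ψ_r(z_r(n)))` of weight `q^{-(j+1)}`, where `z_r(n)` are the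
base-`q` digits of `n`, and the left-hand side expresses the `(u, m, e, s)`-net property
of all `m`-digit-truncated `q ^ m`-blocks of the sequence. -/
theorem stmt3 (q : ℕ) (hq : 2 ≤ q) (F : Type) [Field F] [Fintype F]
    (hcard : Fintype.card F = q) (s u : ℕ) (hs : 1 ≤ s)
    (e : Fin s → ℕ) (he : ∀ i, 1 ≤ e i)
    (c : Fin s → ℕ → ℕ → F)
    (ψ : ℕ → Fin q → F) (hψ : ∀ r, Function.Bijective (ψ r))
    (hψ0 : ∃ R : ℕ, ∀ r, R ≤ r → ψ r ⟨0, by omega⟩ = 0)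
    (lam : Fin s → ℕ → F → Fin q) (hlam : ∀ i j, Function.Bijective (lam i j)) :
    (∀ k m : ℕ, u < m → ∀ d a : Fin s → ℕ, (∀ i, e i ∣ d i) →
        (∀ i, a i < q ^ d i) → u + ∑ i, d i ≤ m →
        Nat.card {n : Fin (q ^ m) // MemElemInterval q d a (fun i =>
            ∑ j ∈ Finset.range m,
              ((lam i j (∑ᶠ r : ℕ, c i j r *
                  ψ r ⟨(k * q ^ m + (n : ℕ)) / q ^ r % q, Nat.mod_lt _ (by omega)⟩) : ℕ) : ℝ)
                / (q : ℝ) ^ (j + 1))}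
          = q ^ (m - ∑ i, d i))
    ↔ (∀ m : ℕ, u < m → ∀ d : Fin s → ℕ, (∀ i, e i ∣ d i) →
        1 ≤ ∑ i, d i → u + ∑ i, d i ≤ m →
        Matrix.rank (Matrix.of fun (p : Σ i : Fin s, Fin (d i)) (r : Fin m) =>
          c p.1 (p.2 : ℕ) (r : ℕ)) = ∑ i, d i) := by
  obtain ⟨R, hR⟩ := hψ0
  have hq0 : 0 < q := by omega
  have hle : ∀ {m : ℕ} {d : Fin s → ℕ}, u + ∑ i, d i ≤ m → ∀ i, d i ≤ m := fun {m d} h i => by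
    have := Finset.single_le_sum (f := d) (fun _ _ => Nat.zero_le _) (Finset.mem_univ i)
    omega
  have hsig : ∀ d : Fin s → ℕ, Fintype.card (Σ i : Fin s, Fin (d i)) = ∑ i, d i := by simp
  constructor
  · intro H m hm d hde _ hdm
    rw [← hsig, Matrix.rank_eq_card_iff_mulVec_surjective]
    intro w
    let K (i : Fin s) (j : ℕ) : F := ∑ t ∈ Finset.range (R + 0),
      c i j (m + t) * ψ (m + t) ⟨0 / q ^ t % q, Nat.mod_lt _ (by omega)⟩
    let γ (i : Fin s) (j : ℕ) : F := if h : j < d i then w ⟨i, ⟨j, h⟩⟩ + K i j else 0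
    have h := H 0 m hm d (fun i => leadingNat q (fun j => lam i j (γ i j)) (d i)) hde
      (fun i => leadingNat_lt (fun j => (lam i j (γ i j)).2) _) hdm
    rw [card_block_memElemInterval hq c ψ hψ hR lam hlam 0 m d (hle hdm) γ] at h
    have hpos : 0 < q ^ (m - ∑ i, d i) := by positivity
    rw [← h] at hpos
    obtain ⟨v, hv⟩ := (Nat.card_pos_iff.1 hpos).1
    refine ⟨v, hv.trans (funext fun p => ?_)⟩
    simp [γ, K]
  · intro H k m hm d a hde ha hdm
    have hsurj : Function.Surjective (Matrix.of fun (p : Σ i : Fin s, Fin (d i)) (r : Fin m) =>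
        c p.1 (p.2 : ℕ) (r : ℕ)).mulVec := by
      rw [← Matrix.rank_eq_card_iff_mulVec_surjective, hsig]
      rcases Nat.eq_zero_or_pos (∑ i, d i) with h0 | hpos
      · have := Matrix.rank_le_card_height (Matrix.of fun (p : Σ i : Fin s, Fin (d i))
          (r : Fin m) => c p.1 (p.2 : ℕ) (r : ℕ))
        rw [hsig] at this
        omega
      · exact H m hm d hde hpos hdm
    choose g hg hga using fun i => exists_leadingNat_eq hq0 (d i) (a i) (ha i)
    choose γ hγ using fun i j => (hlam i j).surjective ⟨g i j, hg i j⟩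
    obtain rfl : (fun i => leadingNat q (fun j => lam i j (γ i j)) (d i)) = a :=
      funext fun i => by simp only [hγ, hga]
    rw [card_block_memElemInterval hq c ψ hψ hR lam hlam k m d (hle hdm) γ,
      Matrix.card_mulVec_fiber _ hsurj, hcard, hsig, Fintype.card_fin]
end

section
/- For every integer m ≥ 3 there exists a point set P of 2^m points in [0,1)^2 with the following two properties: (1) every elementary interval in base 2 of the form J = [0,1) × [a·2^{-3}, (a+1)·2^{-3}) with 0 ≤ a < 2^3 satisfies A(J;P) = 2^{m−3}; (2) there exists an elementary interval in base 2 of the form J' = [a·2^{-2}, (a+1)·2^{-2}) × [0,1) with 0 ≤ a < 2^2 such that A(J';P) ≠ 2^{m−2}. Consequently, with Tezuka's original definition of a (u,m,e,s)-net in base b (which requires A(J;P) = b^m Vol(J) only for elementary intervals J with e_i | d_i and Vol(J) exactly equal to b^{u−m}), the point set P is a (m−3, m, (2,3), 2)-net in base 2 but not a (m−2, m, (2,3), 2)-net in base 2, so the propagation rule in u fails for Tezuka's original definition. -/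
/-- Tezuka's original notion of a `(u, m, e, s)`-net in base `b`: a point set `P` of
`b ^ m` points in `[0,1)^s` such that `A(J;P) = b ^ m · Vol J` for every elementary
interval `J` in base `b` with `e i ∣ d i` for all `i` and `Vol J` exactly `b ^ (u - m)`
(i.e. `u + ∑ d i = m`), in which case `b ^ m · Vol J = b ^ u`. -/
def IsTezukaNet (b m u : ℕ) {s : ℕ} (e : Fin s → ℕ) (P : Fin (b ^ m) → Fin s → ℝ) : Prop :=
  ∀ d a : Fin s → ℕ, (∀ i, e i ∣ d i) → (∀ i, a i < b ^ d i) →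
    u + ∑ i, d i = m →
    Nat.card {n : Fin (b ^ m) // MemElemInterval b d a (P n)} = b ^ u

/-- Among `0, …, 2 ^ (k + 3) - 1`, each residue class modulo `8` has `2 ^ k` members. -/
theorem card_fin_two_pow_mod_eight (k a : ℕ) (ha : a < 8) :
    Nat.card {n : Fin (2 ^ (k + 3)) // n.val % 8 = a} = 2 ^ k := by
  have hk : 2 ^ (k + 3) = 8 * 2 ^ k := by ring
  let e : Fin (2 ^ k) ≃ {n : Fin (2 ^ (k + 3)) // n.val % 8 = a} :=
    { toFun := fun q => ⟨⟨8 * q.val + a, by have := q.isLt; omega⟩, by simp; omega⟩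
      invFun := fun n => ⟨n.val.val / 8, by have := n.val.isLt; omega⟩
      left_inv := fun q => by ext; simp; omega
      right_inv := fun n => by
        have := n.property
        ext
        simp
        omega }
  rw [← Nat.card_congr e, Nat.card_fin]

/-- The points `(0, (n mod 8) / 8)`. -/
noncomputable def columnPoints (N : ℕ) (n : Fin N) : Fin 2 → ℝ :=
  ![0, ((n.val % 8 : ℕ) : ℝ) / 8]

theorem columnPoints_mem_Ico (N : ℕ) (n : Fin N) (i : Fin 2) :
    columnPoints N n i ∈ Set.Ico (0 : ℝ) 1 := by
  fin_cases i
  · simp [columnPoints]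
  · have h : ((n.val % 8 : ℕ) : ℝ) < 8 := by exact_mod_cast Nat.mod_lt _ (by norm_num)
    refine ⟨?_, ?_⟩
    · simp only [columnPoints]
      exact div_nonneg (Nat.cast_nonneg _) (by norm_num)
    · simp only [columnPoints]
      exact (div_lt_one (by norm_num)).2 h

theorem memElemInterval_columnPoints_iff (N a : ℕ) (n : Fin N) :
    MemElemInterval 2 ![0, 3] ![0, a] (columnPoints N n) ↔ n.val % 8 = a := by
  have h8 : (2 : ℝ) ^ 3 = 8 := by norm_num
  simp only [MemElemInterval, Fin.forall_fin_two, columnPoints, Matrix.cons_val_zero,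
    Matrix.cons_val_one, Nat.cast_ofNat, h8]
  rw [div_le_div_iff_of_pos_right (by norm_num), div_lt_div_iff_of_pos_right (by norm_num)]
  norm_cast
  simp
  omega

theorem card_memElemInterval_columnPoints_snd (k a : ℕ) (ha : a < 8) :
    Nat.card {n : Fin (2 ^ (k + 3)) //
      MemElemInterval 2 ![0, 3] ![0, a] (columnPoints _ n)} = 2 ^ k := by
  simp only [memElemInterval_columnPoints_iff]
  exact card_fin_two_pow_mod_eight k a ha

theorem card_memElemInterval_columnPoints_fst (N : ℕ) :
    Nat.card {n : Fin N // MemElemInterval 2 ![2, 0] ![0, 0] (columnPoints N n)} = N := by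
  have h : ∀ n : Fin N, MemElemInterval 2 ![2, 0] ![0, 0] (columnPoints N n) := fun n => by
    have h1 := columnPoints_mem_Ico N n 1
    simp only [MemElemInterval, Fin.forall_fin_two]
    exact ⟨by simp [columnPoints], by simpa using h1⟩
  rw [Nat.card_congr (Equiv.subtypeUnivEquiv h), Nat.card_fin]

/-- For every `m ≥ 3` there is a point set `P` of `2 ^ m` points in `[0,1)^2` such that
(1) every elementary interval `J = [0,1) × [a/2^3, (a+1)/2^3)` contains exactly
`2 ^ (m-3)` points of `P`, while (2) some elementary interval
`J' = [a/2^2, (a+1)/2^2) × [0,1)` does not contain exactly `2 ^ (m-2)` points of `P`;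
consequently `P` is an `(m-3, m, (2,3), 2)`-net in base `2` in Tezuka's original sense
but not an `(m-2, m, (2,3), 2)`-net, so the propagation rule in `u` fails for Tezuka's
original definition. -/
theorem stmt4 (m : ℕ) (hm : 3 ≤ m) :
    ∃ P : Fin (2 ^ m) → Fin 2 → ℝ,
      (∀ n i, P n i ∈ Set.Ico (0 : ℝ) 1) ∧
      (∀ a : ℕ, a < 2 ^ 3 →
        Nat.card {n : Fin (2 ^ m) // MemElemInterval 2 ![0, 3] ![0, a] (P n)}
          = 2 ^ (m - 3)) ∧
      (∃ a : ℕ, a < 2 ^ 2 ∧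
        Nat.card {n : Fin (2 ^ m) // MemElemInterval 2 ![2, 0] ![a, 0] (P n)}
          ≠ 2 ^ (m - 2)) ∧
      IsTezukaNet 2 m (m - 3) ![2, 3] P ∧
      ¬ IsTezukaNet 2 m (m - 2) ![2, 3] P := by
  obtain ⟨k, rfl⟩ := Nat.exists_eq_add_of_le' hm
  have hne : 2 ^ (k + 3) ≠ 2 ^ (k + 3 - 2) := fun h => by
    have := Nat.pow_right_injective le_rfl h
    omega
  refine ⟨columnPoints _, columnPoints_mem_Ico _,
    fun a ha => card_memElemInterval_columnPoints_snd k a ha,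
    ⟨0, by norm_num, by rwa [card_memElemInterval_columnPoints_fst]⟩, ?_, fun h => hne ?_⟩
  · intro d a hd ha hsum
    simp only [Fin.forall_fin_two, Fin.sum_univ_two, Matrix.cons_val_zero,
      Matrix.cons_val_one] at hd ha hsum
    have h0 : d 0 = 0 := by omega
    have h1 : d 1 = 3 := by omega
    rw [h0, h1] at ha
    have hd' : d = ![0, 3] := by
      ext i
      fin_cases i <;> simp [h0, h1]
    have ha' : a = ![0, a 1] := by
      ext i
      fin_cases i
      · simpa using ha.1
      · rfl
    rw [hd', ha']
    exact card_memElemInterval_columnPoints_snd k (a 1) ha.2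
  · rw [← h ![2, 0] ![0, 0] (by simp [Fin.forall_fin_two]) (by simp [Fin.forall_fin_two])
      (by simp), card_memElemInterval_columnPoints_fst]
end

section
/- Let F_q be a finite field with q elements, let p_1,...,p_s ∈ F_q[x] be pairwise distinct monic irreducible polynomials with deg p_i = e_i for 1 ≤ i ≤ s, and let (y_r)_{r≥0} be polynomials in F_q[x] with deg y_r = r for all r ≥ 0. For each 1 ≤ i ≤ s and r ≥ 0, write the p_i-adic expansion y_r = Σ_{k≥0} β^{(i)}_{k,r} p_i^k with β^{(i)}_{k,r} ∈ F_q[x], deg β^{(i)}_{k,r} < e_i (this expansion exists and is unique, with only finitely many nonzero terms). Define matrices C^{(i)} = (c^{(i)}_{j,r})_{j≥1, r≥0} over F_q by c^{(i)}_{k e_i + l, r} = (coefficient of x^{l−1} in β^{(i)}_{k,r}) for k ≥ 0 and 1 ≤ l ≤ e_i. Then for every integer m ≥ 1 and all integers d_1,...,d_s ≥ 0 with e_i | d_i for 1 ≤ i ≤ s and 1 ≤ d_1 + ⋯ + d_s ≤ m, the (d_1 + ⋯ + d_s) × m matrix over F_q formed by the row vectors (c^{(i)}_{j,0},...,c^{(i)}_{j,m−1})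 with 1 ≤ j ≤ d_i and 1 ≤ i ≤ s has rank d_1 + ⋯ + d_s; that is, C^{(1)},...,C^{(s)} are generating matrices of a digital (0,e,s)-sequence in base q with e = (e_1,...,e_s). -/
/-- If the low digits in an expansion in powers of `p` vanish, a power of `p` divides it. -/
theorem pow_dvd_sum_mul_pow_of_digits_eq_zero {R : Type*} [CommSemiring R] (p : R) (b : ℕ → R)
    (n N : ℕ) (hb : ∀ k < n, b k = 0) :
    p ^ n ∣ ∑ k ∈ Finset.range N, b k * p ^ k := by
  refine Finset.dvd_sum fun k _ => ?_
  rcases lt_or_ge k n with hk | hk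
  · simp [hb k hk]
  · exact Dvd.dvd.mul_left (pow_dvd_pow p hk) _

/-- A matrix with as many independent columns as it has rows has full row rank. -/
theorem Matrix.rank_eq_card_of_submatrix_mulVec_injective {F J ι κ : Type*} [Field F]
    [Fintype J] [Fintype ι] [Fintype κ] (A : Matrix J ι F) (g : κ → ι)
    (hcard : Fintype.card κ = Fintype.card J)
    (hA : ∀ v : κ → F, (A.submatrix id g).mulVec v = 0 → v = 0) :
    A.rank = Fintype.card J := by
  classical
  refine le_antisymm A.rank_le_card_height ?_
  have h : (A.submatrix id g).rank = Fintype.card κ := by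
    rw [Matrix.rank, LinearMap.finrank_range_of_inj, Module.finrank_fintype_fun_eq_card]
    exact (injective_iff_map_eq_zero _).2 hA
  rw [← hcard, ← h]
  exact Matrix.rank_submatrix_le A id g


/-- Let `p 1, …, p s` be pairwise distinct monic irreducible polynomials over a finite
field `F` with `q` elements, with `deg (p i) = e i`, and let `y r` be polynomials with
`deg (y r) = r`.  Let `β i k r` be the coefficients of the `p i`-adic expansion
`y r = ∑_{k ≤ r} β i k r · (p i) ^ k` with `deg (β i k r) < e i` (and `β i k r = 0` for
`k > r`).  The generating matrices have entries `c^{(i)}_{j+1, r} = coeff of x^(j % e i)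
in β i (j / e i) r` (rows `j + 1 ≥ 1`, columns `r ≥ 0`).  Then for every `m ≥ 1` and all
`d i ≥ 0` with `e i ∣ d i` and `1 ≤ ∑ d i ≤ m`, the `(∑ d i) × m` matrix formed by the
first `d i` rows of each `C^{(i)}`, restricted to the first `m` columns, has rank
`∑ d i`; i.e. the `C^{(i)}` generate a digital `(0, e, s)`-sequence in base `q`. -/
theorem stmt6 (q : ℕ) (F : Type) [Field F] [Fintype F] (hcard : Fintype.card F = q)
    (s : ℕ) (hs : 1 ≤ s)
    (p : Fin s → Polynomial F) (e : Fin s → ℕ)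
    (hmonic : ∀ i, (p i).Monic) (hirr : ∀ i, Irreducible (p i))
    (hdist : ∀ i j, i ≠ j → p i ≠ p j)
    (hdeg : ∀ i, (p i).natDegree = e i)
    (y : ℕ → Polynomial F) (hy : ∀ r, (y r).degree = (r : WithBot ℕ))
    (β : Fin s → ℕ → ℕ → Polynomial F)
    (hβdeg : ∀ i k r, (β i k r).degree < (e i : WithBot ℕ))
    (hβ0 : ∀ i k r, r < k → β i k r = 0)
    (hexp : ∀ i r, y r = ∑ k ∈ Finset.range (r + 1), β i k r * p i ^ k)
    (m : ℕ) (hm : 1 ≤ m) (d : Fin s → ℕ) (hdvd : ∀ i, e i ∣ d i)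
    (hd1 : 1 ≤ ∑ i, d i) (hdm : ∑ i, d i ≤ m) :
    Matrix.rank (Matrix.of fun (j : Σ i : Fin s, Fin (d i)) (r : Fin m) =>
      (β j.1 ((j.2 : ℕ) / e j.1) (r : ℕ)).coeff ((j.2 : ℕ) % e j.1)) = ∑ i, d i := by
  have hpos : ∀ i, 0 < e i := fun i => hdeg i ▸ (hirr i).natDegree_pos
  have hJ : Fintype.card (Σ i : Fin s, Fin (d i)) = ∑ i, d i := by simp
  rw [← hJ]
  obtain ⟨D, hD⟩ : ∃ D, D = ∑ i, d i := ⟨_, rfl⟩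
  rw [← hD] at hdm hJ
  refine Matrix.rank_eq_card_of_submatrix_mulVec_injective _
    (Fin.castLE hdm) (by rw [hJ, Fintype.card_fin]) fun v hv => ?_
  set f : Polynomial F := ∑ r : Fin D, v r • y r with hf
  have hfdeg : f.degree < (D : WithBot ℕ) := by
    refine (Polynomial.degree_sum_le _ _).trans_lt ?_
    refine (Finset.sup_lt_iff (WithBot.bot_lt_coe D)).2 fun r _ => ?_
    refine (Polynomial.degree_smul_le _ _).trans_lt ?_
    rw [hy]
    exact WithBot.coe_lt_coe.2 r.2
  have hexp' : ∀ i, f = ∑ k ∈ Finset.range D, (∑ r : Fin D, v r • β i k r) * p i ^ k := by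
    intro i
    simp only [hf, Finset.sum_mul]
    rw [Finset.sum_comm]
    refine Finset.sum_congr rfl fun r _ => ?_
    rw [hexp i r, Finset.smul_sum]
    simp only [smul_mul_assoc]
    refine Finset.sum_subset (Finset.range_subset_range.2 r.2) fun k _ hk => ?_
    rw [hβ0 i k r (by simpa using hk)]
    simp
  have hdigit : ∀ i, ∀ k < d i / e i, ∑ r : Fin D, v r • β i k r = 0 := by
    intro i k hk
    ext l
    rw [Polynomial.finsetSum_coeff, Polynomial.coeff_zero]
    rcases lt_or_ge l (e i) with hl | hl
    · have hlt : k * e i + l < d i := by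
        have h1 : (k + 1) * e i ≤ d i :=
          (Nat.mul_le_mul_right _ hk).trans (Nat.div_mul_le_self _ _)
        linarith [Nat.succ_mul k (e i)]
      have h := congrFun hv ⟨i, ⟨k * e i + l, hlt⟩⟩
      have hdiv : (k * e i + l) / e i = k := by
        rw [mul_comm, Nat.mul_add_div (hpos i), Nat.div_eq_of_lt hl, add_zero]
      have hmod : (k * e i + l) % e i = l := by
        rw [mul_comm, Nat.mul_add_mod, Nat.mod_eq_of_lt hl]
      simp only [Matrix.mulVec, dotProduct, Matrix.submatrix_apply, Matrix.of_apply, id,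
        Fin.val_castLE, hdiv, hmod, Pi.zero_apply] at h
      rw [← h]
      exact Finset.sum_congr rfl fun r _ => by rw [Polynomial.coeff_smul, smul_eq_mul, mul_comm]
    · refine Finset.sum_eq_zero fun r _ => ?_
      rw [Polynomial.coeff_smul, Polynomial.coeff_eq_zero_of_degree_lt, smul_zero]
      exact (hβdeg i k r).trans_le (by exact_mod_cast hl)
  have hcop : Pairwise fun i j => IsCoprime (p i) (p j) := fun i j hij =>
    (hirr i).coprime_iff_not_dvd.2 fun h => hdist i j hij <|
      Polynomial.eq_of_monic_of_associated (hmonic i) (hmonic j)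
        ((hirr i).associated_of_dvd (hirr j) h)
  have hdvdf : ∏ i, p i ^ (d i / e i) ∣ f := by
    refine Finset.prod_dvd_of_coprime (fun i _ j _ hij => (hcop hij).pow) fun i _ => ?_
    rw [hexp' i]
    exact pow_dvd_sum_mul_pow_of_digits_eq_zero _ _ _ _ (hdigit i)
  have hf0 : f = 0 := by
    refine Polynomial.eq_zero_of_dvd_of_degree_lt hdvdf ?_
    rw [Polynomial.degree_prod]
    convert hfdeg
    rw [hD, Nat.cast_sum]
    refine Finset.sum_congr rfl fun i _ => ?_
    rw [Polynomial.degree_pow, Polynomial.degree_eq_natDegree (hirr i).ne_zero, hdeg,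
      nsmul_eq_mul, ← Nat.cast_mul, Nat.div_mul_cancel (hdvd i)]
  have hli : LinearIndependent F fun r : Fin D => y r :=
    (Polynomial.Sequence.linearIndependent ⟨y, hy⟩).comp _ Fin.val_injective
  exact funext (Fintype.linearIndependent_iff.1 hli v hf0)
end

section
/- Let s ≥ 1 and v ≥ 1 be integers and let n ≥ 0 be an integer. Define integers l_s, w_s, l_{s−1}, w_{s−1}, ..., l_1, w_1 by successive division with remainder: n = s v l_s + w_s with 0 ≤ w_s < s v; and for i = s−1, s−2, ..., 1, w_{i+1} = i v l_i + w_i with 0 ≤ w_i < i v (so in particular w_2 = v l_1 + w_1 with 0 ≤ w_1 < v). Then for every i ∈ {1,...,s} and every integer a ≥ 0, if n ≥ s v a + i v then l_i + l_{i+1} + ⋯ + l_s ≥ a + 1. -/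
/-- Combinatorial digit lemma: let `s, v ≥ 1` and `n ≥ 0`, and define the quotients and
remainders `l i, w i` (for `1 ≤ i ≤ s`) by successive division with remainder
`n = s·v·(l s) + w s` with `0 ≤ w s < s·v`, and `w (i+1) = i·v·(l i) + w i` with
`0 ≤ w i < i·v` for `i = s-1, …, 1`.  Then for every `1 ≤ i ≤ s` and `a ≥ 0`, if
`n ≥ s·v·a + i·v` then `l i + l (i+1) + ⋯ + l s ≥ a + 1`. -/
theorem stmt7 (s v : ℕ) (hs : 1 ≤ s) (hv : 1 ≤ v) (n : ℕ) (l w : ℕ → ℕ)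
    (hns : n = s * v * l s + w s) (hws : w s < s * v)
    (hrec : ∀ i, 1 ≤ i → i < s → w (i + 1) = i * v * l i + w i)
    (hwlt : ∀ i, 1 ≤ i → i < s → w i < i * v) :
    ∀ i, 1 ≤ i → i ≤ s → ∀ a : ℕ, s * v * a + i * v ≤ n →
      a + 1 ≤ ∑ j ∈ Finset.Icc i s, l j := by
  intro i hi his a ha
  have hn : n ≤ s * v * ∑ j ∈ Finset.Icc i s, l j + w i := by
    clear ha
    induction his using Nat.decreasingInduction with
    | self => simp [hns]
    | of_succ k hk ih =>
      rw [← Finset.add_sum_Ioc_eq_sum_Icc hk.le, ← Finset.Icc_succ_left_eq_Ioc, mul_add]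
      have hks : k * v * l k ≤ s * v * l k := by gcongr
      have hk_rec := hrec k hi hk
      have hk_le := ih (by omega)
      simp only [Nat.succ_eq_succ, Nat.succ_eq_add_one] at *
      omega
  have hw : w i < i * v := by
    rcases his.lt_or_eq with h | rfl
    · exact hwlt i hi h
    · exact hws
  exact Nat.lt_of_mul_lt_mul_left (a := s * v) (by omega)
end

section
/- Let F_q be a finite field with q elements, let p_1,...,p_s ∈ F_q[x] be pairwise distinct monic irreducible polynomials with deg p_i = e_i, and let v = lcm(e_1,...,e_s). Suppose (y_r)_{r≥0} are polynomials in F_q[x] with deg y_r = r such that, for every r ≥ 0, the polynomial ∏_{i=1}^s p_i^{(l_i + l_{i+1} + ⋯ + l_s) v / e_i} divides y_r, where the integers l_1,...,l_s are determined from r by successive division with remainder: r = s v l_s + w_s with 0 ≤ w_s < s v, and w_{i+1} = i v l_i + w_i with 0 ≤ w_i < i v for i = s−1,...,1. Define the matrices C^{(i)} = (c^{(i)}_{j,r})_{j≥1, r≥0} over F_q by c^{(i)}_{k e_i + l, r} = (coefficient of x^{l−1} in β^{(i)}_{k,r}), where y_r = Σ_{k≥0} β^{(i)}_{k,r} p_i^k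 is the p_i-adic expansion with deg β^{(i)}_{k,r} < e_i. Then for every 1 ≤ i ≤ s and every integer d ≥ 1, the d-th row of C^{(i)} has length at most s v ⌊(d−1)/v⌋ + i v; that is, c^{(i)}_{d,r} = 0 for all r ≥ s v ⌊(d−1)/v⌋ + i v. -/
/-- If `p ^ N` divides a `p`-adic expansion with digits of degree less than `deg p`, then the
first `N` digits vanish. -/
theorem padic_digit_eq_zero_of_pow_dvd {F : Type*} [Field F] {p : Polynomial F}
    (hp : p ≠ 0) (n : ℕ) : ∀ (N : ℕ) (b : ℕ → Polynomial F),
      (∀ k, (b k).degree < p.degree) →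
      p ^ N ∣ ∑ k ∈ Finset.range n, b k * p ^ k → ∀ k, k < N → k < n → b k = 0 := by
  induction n with
  | zero => intro N b _ _ k _ hk; omega
  | succ n ih =>
    intro N b hb hN k hkN hkn
    obtain ⟨M, rfl⟩ : ∃ M, N = M + 1 := ⟨N - 1, by omega⟩
    have hsum : ∑ k ∈ Finset.range (n + 1), b k * p ^ k
        = p * (∑ k ∈ Finset.range n, b (k + 1) * p ^ k) + b 0 := by
      rw [Finset.sum_range_succ', Finset.mul_sum]
      congr 1
      · exact Finset.sum_congr rfl fun k _ => by ring
      · simp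
    rw [hsum] at hN
    have h0 : b 0 = 0 := by
      refine Polynomial.eq_zero_of_dvd_of_degree_lt ?_ (hb 0)
      exact (dvd_add_right (dvd_mul_right p _)).1 ((dvd_pow_self p M.succ_ne_zero).trans hN)
    rw [h0, add_zero, pow_succ', mul_dvd_mul_iff_left hp] at hN
    cases k with
    | zero => exact h0
    | succ k =>
      exact ih M (fun k => b (k + 1)) (fun k => hb _) hN k (by omega) (by omega)

/-- In the successive divisions `w (j + 1) = j * v * l j + w j`, a remainder `w (t + 1) ≥ i * v`
forces one of the quotients `l i, …, l t` to be positive. -/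
theorem one_le_sum_quotients {s v i : ℕ} {l w : ℕ → ℕ} (hi : 1 ≤ i)
    (hrec : ∀ j, 1 ≤ j → j < s → w (j + 1) = j * v * l j + w j)
    (hwlt : ∀ j, 1 ≤ j → j < s → w j < j * v) (t : ℕ) (hit : i ≤ t) :
    t < s → i * v ≤ w (t + 1) → 1 ≤ ∑ j ∈ Finset.Icc i t, l j := by
  induction t, hit using Nat.le_induction with
  | base =>
    intro his hw
    rw [Finset.Icc_self, Finset.sum_singleton]
    by_contra! h
    have h0 : l i = 0 := by omega
    have h1 := hrec i hi his
    have h2 := hwlt i hi his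
    rw [h0, mul_zero] at h1
    omega
  | succ t hit ih =>
    intro hts hw
    rw [Finset.sum_Icc_succ_top (by omega)]
    by_contra! h
    have h0 : l (t + 1) = 0 := by omega
    have h1 := hrec (t + 1) (by omega) hts
    rw [h0, mul_zero] at h1
    have := ih (by omega) (by omega)
    omega

/-- If `r ≥ s * v * m + i * v`, the quotients `l i, …, l s` of the successive divisions of `r`
sum to more than `m`. -/
theorem lt_sum_quotients {s v i r m : ℕ} {l w : ℕ → ℕ} (hi : 1 ≤ i) (his : i ≤ s)
    (hls : r = s * v * l s + w s) (hws : w s < s * v)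
    (hrec : ∀ j, 1 ≤ j → j < s → w (j + 1) = j * v * l j + w j)
    (hwlt : ∀ j, 1 ≤ j → j < s → w j < j * v) (hr : s * v * m + i * v ≤ r) :
    m < ∑ j ∈ Finset.Icc i s, l j := by
  have hle : m ≤ l s := by
    by_contra! h
    have := Nat.mul_le_mul_left (s * v) (Nat.succ_le_of_lt h)
    rw [Nat.mul_succ] at this
    omega
  obtain rfl | hlt := his.eq_or_lt
  · rw [Finset.Icc_self, Finset.sum_singleton]
    refine hle.lt_of_ne ?_
    rintro rfl
    omega
  · obtain ⟨t, rfl⟩ : ∃ t, s = t + 1 := ⟨s - 1, by omega⟩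
    rw [Finset.sum_Icc_succ_top (by omega)]
    obtain heq | h := hle.eq_or_lt
    · rw [← heq] at hls
      have := one_le_sum_quotients hi hrec hwlt t (by omega) (by omega) (by omega)
      omega
    · omega


/-- Row-length bound (genus-zero instance of Theorem 2 of the paper).  Let
`p 1, …, p s` be pairwise distinct monic irreducible polynomials over a finite field
`F` with `q` elements, `deg (p i) = e i`, and `v = lcm (e 1, …, e s)`.  Let `y r` be
polynomials with `deg (y r) = r` such that `∏_i (p i) ^ ((l_i + ⋯ + l_s)·v / e i)`
divides `y r`, where (for each `r`) the integers `l r i, w r i` are determined by the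
successive divisions `r = s·v·(l r s) + w r s` (`0 ≤ w r s < s·v`) and
`w r (i+1) = i·v·(l r i) + w r i` (`0 ≤ w r i < i·v`).  With `β i k r` the coefficients
of the `p i`-adic expansion `y r = ∑_{k ≤ r} (β i k r)·(p i) ^ k`, `deg (β i k r) < e i`,
the matrix entries are `c^{(i)}_{d,r} = coeff of x^((d-1) % e i) in β i ((d-1) / e i) r`.
Then the `d`-th row of `C^{(i)}` has length at most `s·v·⌊(d-1)/v⌋ + i·v`, i.e.
`c^{(i)}_{d,r} = 0` for all `r ≥ s·v·⌊(d-1)/v⌋ + i·v`. -/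
theorem stmt8 (q : ℕ) (F : Type) [Field F] [Fintype F] (hcard : Fintype.card F = q)
    (s v : ℕ) (hs : 1 ≤ s)
    (p : ℕ → Polynomial F) (e : ℕ → ℕ)
    (hmonic : ∀ i, 1 ≤ i → i ≤ s → (p i).Monic)
    (hirr : ∀ i, 1 ≤ i → i ≤ s → Irreducible (p i))
    (hdist : ∀ i j, 1 ≤ i → i ≤ s → 1 ≤ j → j ≤ s → i ≠ j → p i ≠ p j)
    (hdeg : ∀ i, 1 ≤ i → i ≤ s → (p i).natDegree = e i)
    (hv : v = (Finset.Icc 1 s).lcm e)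
    (y : ℕ → Polynomial F) (hy : ∀ r, (y r).degree = (r : WithBot ℕ))
    (l w : ℕ → ℕ → ℕ)
    (hls : ∀ r, r = s * v * l r s + w r s) (hws : ∀ r, w r s < s * v)
    (hrec : ∀ r i, 1 ≤ i → i < s → w r (i + 1) = i * v * l r i + w r i)
    (hwlt : ∀ r i, 1 ≤ i → i < s → w r i < i * v)
    (hdvd : ∀ r, (∏ i ∈ Finset.Icc 1 s,
        p i ^ ((∑ j ∈ Finset.Icc i s, l r j) * v / e i)) ∣ y r)
    (β : ℕ → ℕ → ℕ → Polynomial F)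
    (hβdeg : ∀ i k r, 1 ≤ i → i ≤ s → (β i k r).degree < (e i : WithBot ℕ))
    (hβ0 : ∀ i k r, 1 ≤ i → i ≤ s → r < k → β i k r = 0)
    (hexp : ∀ i r, 1 ≤ i → i ≤ s →
      y r = ∑ k ∈ Finset.range (r + 1), β i k r * p i ^ k) :
    ∀ i, 1 ≤ i → i ≤ s → ∀ d : ℕ, 1 ≤ d → ∀ r : ℕ,
      s * v * ((d - 1) / v) + i * v ≤ r →
      (β i ((d - 1) / e i) r).coeff ((d - 1) % e i) = 0 := by
  intro i hi his d _ r hr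
  have hvpos : 0 < v := Nat.pos_of_mul_pos_left ((Nat.zero_le _).trans_lt (hws 0))
  have hdv : e i ∣ v := hv ▸ Finset.dvd_lcm (Finset.mem_Icc.2 ⟨hi, his⟩)
  have hepos : 0 < e i := Nat.pos_of_dvd_of_pos hdv hvpos
  have hp : p i ≠ 0 := (hirr i hi his).ne_zero
  have hlt := lt_sum_quotients hi his (hls r) (hws r) (hrec r) (hwlt r) hr
  have hk : (d - 1) / e i < (∑ j ∈ Finset.Icc i s, l r j) * v / e i := by
    rw [Nat.div_lt_iff_lt_mul hepos, Nat.div_mul_cancel (hdv.mul_left _)]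
    exact (Nat.div_lt_iff_lt_mul hvpos).1 hlt
  have hdvdi := (Finset.dvd_prod_of_mem (fun i => p i ^ ((∑ j ∈ Finset.Icc i s, l r j) * v / e i))
    (Finset.mem_Icc.2 ⟨hi, his⟩)).trans (hdvd r)
  rw [hexp i r hi his] at hdvdi
  have hzero : β i ((d - 1) / e i) r = 0 := by
    rcases lt_or_ge r ((d - 1) / e i) with h | h
    · exact hβ0 i _ r hi his h
    · refine padic_digit_eq_zero_of_pow_dvd hp (r + 1) _ (fun k => β i k r) (fun k => ?_) hdvdi _
        hk (by omega)
      rw [Polynomial.degree_eq_natDegree hp, hdeg i hi his]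
      exact hβdeg i k r hi his
  rw [hzero, Polynomial.coeff_zero]
end
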